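/- arXiv:1110.4660 — 2 statements merged into one kernel-verified Lean document; each statement's English description precedes it below -/
import Mathlib

section
/- Let d ≥ 1 and let G be a multigraph on vertex set V = {1,…,n} with edge set E, |E| = binom(d+1,2)(n−1) + d². If some presentation of G has rigidity matrix of rank |E|, then E decomposes as a disjoint union E = F₁ ⊔ F₂ where F₁ is (d,d)-tight (so |F₁| = dn − d) and F₂ is (binom(d,2), binom(d+1,2))-tight (so |F₂| = binom(d,2)·n + binom(d+1,2)). (Necessity direction of the Maxwell–Laman characterization for periodic body-and-bar frameworks.) -/
open Matrix

/-- The space of unknowns (infinitesimal motions) of a `d`-periodic body-and-bar framework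
with `n` body orbits: a translation vector `ṗ_v ∈ ℝ^d` for each vertex, an (unrestricted)
matrix `B_v` for each vertex whose skew-symmetrization `B_v - B_vᵀ` plays the role of the
skew-symmetric rotation unknown `A_v`, and a matrix `Λ̇`. -/
abbrev RigDom (d n : ℕ) :=
  (Fin n → Fin d → ℝ) × (Fin n → Matrix (Fin d) (Fin d) ℝ) × Matrix (Fin d) (Fin d) ℝ

/-- The edge vector `h(e) = Λ c(e) + q⁺(e) − q⁻(e)` of an edge. -/
noncomputable def edgeVec {E : Type*} (d : ℕ)
    (Λ : Matrix (Fin d) (Fin d) ℝ) (c : E → Fin d → ℤ) (qm qp : E → Fin d → ℝ)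
    (e : E) : Fin d → ℝ :=
  Λ.mulVec (fun r => (c e r : ℝ)) + qp e - qm e

/-- The value of the row of the rigidity matrix indexed by the edge `e`, evaluated at the
vector of unknowns `x`. -/
noncomputable def rowVal {E : Type*} (d n : ℕ) (tail head : E → Fin n)
    (Λ : Matrix (Fin d) (Fin d) ℝ) (c : E → Fin d → ℤ) (qm qp : E → Fin d → ℝ)
    (x : RigDom d n) (e : E) : ℝ :=
  (x.2.2.mulVec (fun r => (c e r : ℝ))
      + (x.2.1 (head e) - (x.2.1 (head e))ᵀ).mulVec (qp e)
      - (x.2.1 (tail e) - (x.2.1 (tail e))ᵀ).mulVec (qm e)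
      + x.1 (head e) - x.1 (tail e))
    ⬝ᵥ edgeVec d Λ c qm qp e

/-- The rank of the submatrix of the rigidity matrix formed by the rows indexed by `F`. -/
noncomputable def rigidityRank {E : Type*} (d n : ℕ) (tail head : E → Fin n)
    (Λ : Matrix (Fin d) (Fin d) ℝ) (c : E → Fin d → ℤ) (qm qp : E → Fin d → ℝ)
    (F : Finset E) : ℕ :=
  Module.finrank ℝ (Submodule.span ℝ
    (Set.range fun x : RigDom d n => fun e : F => rowVal d n tail head Λ c qm qp x e.1))

/-- An edge set `F` is `(a,b)`-sparse if every nonempty `U ⊆ V` spans at most `a|U| + b`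
edges of `F`. -/
def Sparse {V E : Type*} [DecidableEq V] [DecidableEq E] (tail head : E → V)
    (a : ℕ) (b : ℤ) (F : Finset E) : Prop :=
  ∀ U : Finset V, U.Nonempty →
    ((F.filter fun e => tail e ∈ U ∧ head e ∈ U).card : ℤ) ≤ a * U.card + b

/-- An edge set `F` is `(a,b)`-tight if it is `(a,b)`-sparse and `|F| = a|V| + b`. -/
def Tight {V E : Type*} [Fintype V] [DecidableEq V] [DecidableEq E] (tail head : E → V)
    (a : ℕ) (b : ℤ) (F : Finset E) : Prop :=
  Sparse tail head a b F ∧ (F.card : ℤ) = a * Fintype.card V + b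


/-- If the family `a + b` is linearly independent, then some mixed family is. -/
theorem exists_piecewise_indep {E V : Type*} [Fintype E] [DecidableEq E] [AddCommGroup V]
    [Module ℝ V] (a b : E → V) (h : LinearIndependent ℝ (a + b)) :
    ∃ S : Finset E, LinearIndependent ℝ (S.piecewise a b) := by
  obtain ⟨g, hg⟩ := LinearMap.exists_leftInverse_of_injective
    (Fintype.linearCombination ℝ (a + b))
    (LinearMap.ker_eq_bot.mpr (linearIndependent_iff_injective_fintypeLinearCombination.mp h))
  let ω : V [⋀^E]→ₗ[ℝ] ℝ := (Matrix.detRowAlternating (R := ℝ) (n := E)).compLinearMap g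
  have h1 : ω (a + b) = 1 := by
    have : (fun e => g ((a + b) e)) = (1 : Matrix E E ℝ) := by
      funext e
      have h2 := LinearMap.congr_fun hg (Pi.single e 1)
      simp only [LinearMap.comp_apply, Fintype.linearCombination_apply_single, one_smul,
        LinearMap.id_apply] at h2
      rw [h2]
      ext i
      simp [Matrix.one_apply, Pi.single_apply, eq_comm]
    change Matrix.det (fun e => g ((a + b) e)) = 1
    rw [this, Matrix.det_one]
  have h3 : ω (a + b) = ∑ S : Finset E, ω (S.piecewise a b) :=
    ω.toMultilinearMap.map_add_univ a b
  have h4 : ∑ S : Finset E, ω (S.piecewise a b) ≠ 0 := by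
    rw [← h3, h1]; exact one_ne_zero
  obtain ⟨S, -, hS⟩ := Finset.exists_ne_zero_of_sum_ne_zero h4
  refine ⟨S, ?_⟩
  by_contra hc
  exact hS (ω.map_linearDependent _ hc)

/-- A linearly independent family in the span of `g` is no larger than the index type of `g`. -/
theorem card_le_of_indep_span {V κ E : Type*} [AddCommGroup V] [Module ℝ V] [Fintype κ]
    [DecidableEq E] (g : κ → V) (f : E → V) (F : Finset E)
    (hf : LinearIndependent ℝ (fun e : F => f e)) (hs : ∀ e ∈ F, f e ∈ Submodule.span ℝ (Set.range g)) :
    F.card ≤ Fintype.card κ := by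
  have h1 : Fintype.card F ≤ Module.finrank ℝ (Submodule.span ℝ (Set.range g)) := by
    have : LinearIndependent ℝ
        (fun e : F => (⟨f e, hs e e.2⟩ : Submodule.span ℝ (Set.range g))) :=
      LinearIndependent.of_comp (Submodule.span ℝ (Set.range g)).subtype hf
    have : Module.Finite ℝ (Submodule.span ℝ (Set.range g)) :=
      Module.Finite.span_of_finite ℝ (Set.finite_range g)
    exact LinearIndependent.fintype_card_le_finrank ‹_›
  rw [Fintype.card_coe] at h1
  exact h1.trans (finrank_range_le_card g)

/-- The translational part of a row. -/
noncomputable def rowA {E : Type*} (d n : ℕ) (tail head : E → Fin n)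
    (Λ : Matrix (Fin d) (Fin d) ℝ) (c : E → Fin d → ℤ) (qm qp : E → Fin d → ℝ)
    (e : E) (x : RigDom d n) : ℝ :=
  (x.1 (head e) - x.1 (tail e)) ⬝ᵥ edgeVec d Λ c qm qp e

/-- The rotational and lattice part of a row. -/
noncomputable def rowB {E : Type*} (d n : ℕ) (tail head : E → Fin n)
    (Λ : Matrix (Fin d) (Fin d) ℝ) (c : E → Fin d → ℤ) (qm qp : E → Fin d → ℝ)
    (e : E) (x : RigDom d n) : ℝ :=
  (x.2.2.mulVec (fun r => (c e r : ℝ))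
      + (x.2.1 (head e) - (x.2.1 (head e))ᵀ).mulVec (qp e)
      - (x.2.1 (tail e) - (x.2.1 (tail e))ᵀ).mulVec (qm e)) ⬝ᵥ edgeVec d Λ c qm qp e

theorem rows_indep {d n : ℕ} {E : Type*} [Fintype E] [DecidableEq E]
    (tail head : E → Fin n)
    (Λ : Matrix (Fin d) (Fin d) ℝ) (c : E → Fin d → ℤ) (qm qp : E → Fin d → ℝ)
    (hrank : rigidityRank d n tail head Λ c qm qp Finset.univ = Fintype.card E) :
    LinearIndependent ℝ (rowA d n tail head Λ c qm qp + rowB d n tail head Λ c qm qp) := by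
  have hspan : Submodule.span ℝ (Set.range fun x : RigDom d n =>
      fun e : (Finset.univ : Finset E) => rowVal d n tail head Λ c qm qp x e.1) = ⊤ := by
    apply Submodule.eq_top_of_finrank_eq
    unfold rigidityRank at hrank
    rw [hrank]
    simp
  rw [Fintype.linearIndependent_iff]
  intro g hg
  have key : ∀ y : (((Finset.univ : Finset E) : Type _) → ℝ), ∑ e : ((Finset.univ : Finset E) : Type _), g e * y e = 0 := by
    intro y
    have hy : y ∈ Submodule.span ℝ (Set.range fun x : RigDom d n =>
      fun e : (Finset.univ : Finset E) => rowVal d n tail head Λ c qm qp x e.1) := by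
      rw [hspan]; trivial
    induction hy using Submodule.span_induction with
    | mem y hy =>
      obtain ⟨x, rfl⟩ := hy
      have := congrFun hg x
      simp only [Finset.sum_apply, Pi.smul_apply, Pi.add_apply, smul_eq_mul, Pi.zero_apply] at this
      refine (Finset.sum_coe_sort (Finset.univ : Finset E)
        (fun e => g e * rowVal d n tail head Λ c qm qp x e)).trans ?_
      refine Eq.trans ?_ this
      refine Finset.sum_congr rfl fun e _ => ?_
      congr 1
      simp only [rowVal, rowA, rowB, ← add_dotProduct]
      congr 1
      abel
    | zero => simp
    | add y z _ _ h1 h2 => simp [mul_add, Finset.sum_add_distrib] at h1 h2 ⊢; linarith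
    | smul t y _ h1 =>
      rw [← mul_zero t, ← h1, Finset.mul_sum]
      refine Finset.sum_congr rfl fun e _ => ?_
      simp only [Pi.smul_apply, smul_eq_mul]; ring
  intro e
  have := key (Pi.single (⟨e, Finset.mem_univ e⟩ : (Finset.univ : Finset E)) 1)
  simpa [Pi.single_apply] using this

theorem rowA_mem {d n : ℕ} {E : Type*} (tail head : E → Fin n)
    (Λ : Matrix (Fin d) (Fin d) ℝ) (c : E → Fin d → ℤ) (qm qp : E → Fin d → ℝ)
    (U : Finset (Fin n)) (u : Fin n) (e : E) (ht : tail e ∈ U) (hh : head e ∈ U) :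
    rowA d n tail head Λ c qm qp e ∈ Submodule.span ℝ (Set.range
      (fun (k : (U.erase u) × Fin d) (x : RigDom d n) => x.1 k.1 k.2 - x.1 u k.2)) := by
  set W := Submodule.span ℝ (Set.range
      (fun (k : (U.erase u) × Fin d) (x : RigDom d n) => x.1 k.1 k.2 - x.1 u k.2)) with hW
  have h1 : ∀ v ∈ U, ∀ r : Fin d, (fun x : RigDom d n => x.1 v r - x.1 u r) ∈ W := by
    intro v hv r
    by_cases hvu : v = u
    · subst hvu
      simp only [sub_self]
      exact W.zero_mem
    · exact Submodule.subset_span ⟨(⟨v, Finset.mem_erase.mpr ⟨hvu, hv⟩⟩, r), rfl⟩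
  have h2 : rowA d n tail head Λ c qm qp e = ∑ r, edgeVec d Λ c qm qp e r •
      ((fun x : RigDom d n => x.1 (head e) r - x.1 u r) - (fun x : RigDom d n => x.1 (tail e) r - x.1 u r)) := by
    funext x
    simp only [rowA, dotProduct, Finset.sum_apply, Pi.smul_apply, Pi.sub_apply, smul_eq_mul]
    refine Finset.sum_congr rfl fun r _ => ?_
    ring
  rw [h2]
  exact W.sum_mem fun r _ => W.smul_mem _ (W.sub_mem (h1 _ hh r) (h1 _ ht r))

/-- Spanning functionals for the rotational and lattice part. -/
noncomputable def genB {d n : ℕ} (Λ : Matrix (Fin d) (Fin d) ℝ) (U : Finset (Fin n)) (u : Fin n) :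
    ((U.erase u) × (Σ j : Fin d, Fin j)) ⊕ (Fin d × Fin d) → RigDom d n → ℝ
  | Sum.inl (v, ⟨j, i⟩), x =>
      ((x.2.1 v - (x.2.1 v)ᵀ) - (x.2.1 u - (x.2.1 u)ᵀ)) j (Fin.castLE j.2.le i)
  | Sum.inr (r, s), x => (x.2.2 - (x.2.1 u - (x.2.1 u)ᵀ) * Λ) r s

theorem skew_dot {d : ℕ} (B : Matrix (Fin d) (Fin d) ℝ) (h : Fin d → ℝ) :
    ((B - Bᵀ).mulVec h) ⬝ᵥ h = 0 := by
  rw [sub_mulVec, sub_dotProduct, mulVec_transpose, ← dotProduct_mulVec, dotProduct_comm, sub_self]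

theorem rowB_mem {d n : ℕ} {E : Type*} (tail head : E → Fin n)
    (Λ : Matrix (Fin d) (Fin d) ℝ) (c : E → Fin d → ℤ) (qm qp : E → Fin d → ℝ)
    (U : Finset (Fin n)) (u : Fin n) (e : E) (ht : tail e ∈ U) (hh : head e ∈ U) :
    rowB d n tail head Λ c qm qp e ∈ Submodule.span ℝ (Set.range (genB Λ U u)) := by
  set W := Submodule.span ℝ (Set.range (genB Λ U u)) with hW
  have h0 : ∀ r s : Fin d,
      (fun x : RigDom d n => (x.2.2 - (x.2.1 u - (x.2.1 u)ᵀ) * Λ) r s) ∈ W :=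
    fun r s => Submodule.subset_span ⟨Sum.inr (r, s), rfl⟩
  have h1 : ∀ v ∈ U, ∀ r s : Fin d, s < r → (fun x : RigDom d n =>
      ((x.2.1 v - (x.2.1 v)ᵀ) - (x.2.1 u - (x.2.1 u)ᵀ)) r s) ∈ W := by
    intro v hv r s hsr
    by_cases hvu : v = u
    · subst hvu
      simp only [sub_self]
      exact W.zero_mem
    · exact Submodule.subset_span
        ⟨Sum.inl (⟨v, Finset.mem_erase.mpr ⟨hvu, hv⟩⟩, ⟨r, ⟨s, hsr⟩⟩), rfl⟩
  have h2 : ∀ v ∈ U, ∀ r s : Fin d, (fun x : RigDom d n =>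
      ((x.2.1 v - (x.2.1 v)ᵀ) - (x.2.1 u - (x.2.1 u)ᵀ)) r s) ∈ W := by
    intro v hv r s
    rcases lt_trichotomy s r with h | h | h
    · exact h1 v hv r s h
    · subst h
      convert W.zero_mem using 1
      funext x
      simp
    · convert W.neg_mem (h1 v hv s r h) using 1
      funext x
      simp
      ring
  have h3 : ∀ M : RigDom d n → Matrix (Fin d) (Fin d) ℝ, (∀ r s, (fun x => M x r s) ∈ W) →
      ∀ q h : Fin d → ℝ, (fun x => (M x).mulVec q ⬝ᵥ h) ∈ W := by
    intro M hM q h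
    have : (fun x => (M x).mulVec q ⬝ᵥ h) = ∑ r, ∑ s, (q s * h r) • (fun x => M x r s) := by
      funext x
      simp only [dotProduct, mulVec, Finset.sum_apply, Pi.smul_apply, smul_eq_mul, Finset.sum_mul]
      refine Finset.sum_congr rfl fun r _ => Finset.sum_congr rfl fun s _ => ?_
      ring
    rw [this]
    exact W.sum_mem fun r _ => W.sum_mem fun s _ => W.smul_mem _ (hM r s)
  have h4 := W.sub_mem (W.add_mem
    (h3 _ h0 (fun r => (c e r : ℝ)) (edgeVec d Λ c qm qp e))
    (h3 _ (h2 _ hh) (qp e) (edgeVec d Λ c qm qp e)))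
    (h3 _ (h2 _ ht) (qm e) (edgeVec d Λ c qm qp e))
  convert h4 using 1
  funext x
  have h5 := skew_dot (x.2.1 u) (edgeVec d Λ c qm qp e)
  have h6 : (x.2.1 u - (x.2.1 u)ᵀ).mulVec (edgeVec d Λ c qm qp e) =
      ((x.2.1 u - (x.2.1 u)ᵀ) * Λ).mulVec (fun r => (c e r : ℝ))
      + (x.2.1 u - (x.2.1 u)ᵀ).mulVec (qp e) - (x.2.1 u - (x.2.1 u)ᵀ).mulVec (qm e) := by
    rw [edgeVec, mulVec_sub, mulVec_add, mulVec_mulVec]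
  rw [h6] at h5
  simp only [rowB, Pi.add_apply, Pi.sub_apply]
  generalize x.2.1 u - (x.2.1 u)ᵀ = A at *
  simp only [sub_mulVec _ A, sub_mulVec _ (A * Λ), add_dotProduct, sub_dotProduct] at h5 ⊢
  linarith

theorem card_pairs (d : ℕ) : Fintype.card (Σ j : Fin d, Fin j) = d.choose 2 := by
  rw [Fintype.card_sigma]
  simp only [Fintype.card_fin]
  rw [Fin.sum_univ_eq_sum_range (fun i => i) d, Finset.sum_range_id, Nat.choose_two_right]

/-- necessity in the Maxwell–Laman characterization for periodic
body-and-bar frameworks.  If `|E| = C(d+1,2)(n−1) + d²` and some presentation has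
rigidity matrix of full rank `|E|`, then the edge set decomposes as a disjoint union
`E = F₁ ⊔ F₂` with `F₁` `(d,d)`-tight (`|F₁| = dn − d`) and `F₂`
`(C(d,2), C(d+1,2))`-tight (`|F₂| = C(d,2)·n + C(d+1,2)`). -/
theorem stmt_8 {d n : ℕ} (hd : 1 ≤ d) (hn : 1 ≤ n) {E : Type*} [Fintype E] [DecidableEq E]
    (tail head : E → Fin n)
    (hE : Fintype.card E + (d + 1).choose 2 = (d + 1).choose 2 * n + d ^ 2)
    (Λ : Matrix (Fin d) (Fin d) ℝ) (c : E → Fin d → ℤ) (qm qp : E → Fin d → ℝ)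
    (hΛ : IsUnit Λ) (hh : ∀ e, edgeVec d Λ c qm qp e ≠ 0)
    (hrank : rigidityRank d n tail head Λ c qm qp Finset.univ = Fintype.card E) :
    ∃ F₁ F₂ : Finset E, Disjoint F₁ F₂ ∧ F₁ ∪ F₂ = Finset.univ ∧
      Tight tail head d (-(d : ℤ)) F₁ ∧
      Tight tail head (d.choose 2) ((d + 1).choose 2 : ℤ) F₂ := by
  classical
  obtain ⟨S, hS⟩ := exists_piecewise_indep _ _ (rows_indep tail head Λ c qm qp hrank)
  have hc1 : (d + 1).choose 2 = d + d.choose 2 := by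
    rw [Nat.choose_succ_succ' d 1, Nat.choose_one_right]
  have hc2 : d ^ 2 = d.choose 2 + (d + 1).choose 2 := by
    have h := Nat.triangle_succ d
    have := Finset.sum_range_id_mul_two d
    rw [Finset.sum_range_id, ← Nat.choose_two_right] at this
    rw [hc1]
    obtain ⟨k, rfl⟩ : ∃ k, d = k + 1 := ⟨d - 1, by omega⟩
    simp only [Nat.add_sub_cancel] at this
    nlinarith
  have hA : Sparse tail head d (-(d : ℤ)) S := by
    intro U hU
    obtain ⟨u, hu⟩ := hU
    have h1 := card_le_of_indep_span _ (rowA d n tail head Λ c qm qp)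
      (S.filter fun e => tail e ∈ U ∧ head e ∈ U) (by
        convert hS.comp (fun e : (S.filter fun e => tail e ∈ U ∧ head e ∈ U) => (e : E))
          Subtype.val_injective using 1
        funext e
        have := (Finset.mem_filter.mp e.2).1
        simp [Finset.piecewise, this])
      (fun e he => by
        obtain ⟨-, h2, h3⟩ := Finset.mem_filter.mp he
        exact rowA_mem tail head Λ c qm qp U u e h2 h3)
    rw [Fintype.card_prod, Fintype.card_coe, Fintype.card_fin] at h1
    have h2 := Finset.card_erase_add_one hu
    rw [← h2]
    push_cast
    have h3 : ((S.filter fun e => tail e ∈ U ∧ head e ∈ U).card : ℤ) ≤ (U.erase u).card * d := by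
      exact_mod_cast h1
    linarith
  have hB : Sparse tail head (d.choose 2) ((d + 1).choose 2 : ℤ) Sᶜ := by
    intro U hU
    obtain ⟨u, hu⟩ := hU
    have h1 := card_le_of_indep_span _ (rowB d n tail head Λ c qm qp)
      (Sᶜ.filter fun e => tail e ∈ U ∧ head e ∈ U) (by
        convert hS.comp (fun e : (Sᶜ.filter fun e => tail e ∈ U ∧ head e ∈ U) => (e : E))
          Subtype.val_injective using 1
        funext e
        have := Finset.mem_compl.mp (Finset.mem_filter.mp e.2).1
        simp [Finset.piecewise, this])
      (fun e he => by
        obtain ⟨-, h2, h3⟩ := Finset.mem_filter.mp he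
        exact rowB_mem tail head Λ c qm qp U u e h2 h3)
    rw [Fintype.card_sum, Fintype.card_prod, Fintype.card_prod, Fintype.card_coe, card_pairs,
      Fintype.card_fin] at h1
    have h2 := Finset.card_erase_add_one hu
    rw [← h2]
    have h3 : (Sᶜ.filter fun e => tail e ∈ U ∧ head e ∈ U).card ≤
        d.choose 2 * ((U.erase u).card + 1) + (d + 1).choose 2 := by
      nlinarith
    exact_mod_cast h3
  have hu : (Finset.univ : Finset (Fin n)).Nonempty := ⟨⟨0, hn⟩, Finset.mem_univ _⟩
  have kA := hA Finset.univ hu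
  have kB := hB Finset.univ hu
  simp only [Finset.mem_univ, and_self, Finset.filter_true, Finset.card_univ,
    Fintype.card_fin] at kA kB
  have hcard : (S.card : ℤ) + (Sᶜ.card : ℤ) = Fintype.card E := by
    exact_mod_cast Finset.card_add_card_compl S
  have hE' : (Fintype.card E : ℤ) + ((d + 1).choose 2 : ℕ) = ((d + 1).choose 2 : ℕ) * n + ((d ^ 2 : ℕ) : ℤ) := by
    exact_mod_cast hE
  rw [hc2, hc1] at hE'
  rw [hc1] at kB
  push_cast at hE' kB
  refine ⟨S, Sᶜ, disjoint_compl_right, Finset.union_compl S, ⟨hA, ?_⟩, ⟨hB, ?_⟩⟩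
  · rw [Fintype.card_fin]; nlinarith
  · rw [Fintype.card_fin, hc1]; push_cast; nlinarith
end

section
/- Let d ≥ 1, n ≥ 1, and let N > n be an integer. Let G be a multigraph on V = {1,…,n} whose edge set is partitioned as E = T₁ ⊔ ⋯ ⊔ T_d ⊔ (⊔_{1 ≤ i < j ≤ d} F_{ij}) ⊔ U, where each T_i is a spanning tree, each F_{ij} is a spanning pseudo-forest whose edges are oriented (tails and heads designated) so that every vertex has in-degree exactly one, and U = {e*_{ij} : 1 ≤ j ≤ i ≤ d} consists of binom(d+1,2) further edges with arbitrary endpoints. Define a presentation by: Λ = I_d; for e ∈ T_i: c(e) = 𝐞_i and q⁻(e) = q⁺(e) = 0; for e ∈ F_{ij} (i < j): c(e) = 𝐞_j, q⁻(e) = 0, q⁺(e) = 𝐞_i; for e*_{ij} ∈ U: c(e*_{ij}) = N(𝐞_i + 𝐞_j) and q⁻(e*_{ij}) = q⁺(e*_{ij}) = 0. Then the rigidity matrix of this presentation has rank |E| = binom(d+1,2)(n−1) + d². (Proposition: explicit generic lifting realizing full rank.) -/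
open Matrix

/-- Two vertices are adjacent through `F` if some edge of `F` joins them. -/
def adjRel {V E : Type*} (tail head : E → V) (F : Finset E) (u v : V) : Prop :=
  ∃ e ∈ F, (tail e = u ∧ head e = v) ∨ (tail e = v ∧ head e = u)

/-- `T` is a spanning tree: `|T| = |V| − 1` and `(V, T)` is connected. -/
def IsSpanningTree {V E : Type*} [Fintype V] (tail head : E → V) (T : Finset E) : Prop :=
  T.card + 1 = Fintype.card V ∧ ∀ u v : V, Relation.EqvGen (adjRel tail head T) u v

lemma aux_row_T {E : Type*} (d n : ℕ) (tail head : E → Fin n)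
    (c : E → Fin d → ℤ) (qm qp : E → Fin d → ℝ) (x : RigDom d n) (e : E) (i : Fin d)
    (h1 : ∀ r, c e r = if r = i then 1 else 0) (h2 : qm e = 0) (h3 : qp e = 0) :
    rowVal d n tail head 1 c qm qp x e = x.2.2 i i + x.1 (head e) i - x.1 (tail e) i := by
  have hc : (fun r => (c e r : ℝ)) = Pi.single i 1 := by
    funext r; rw [h1 r, Pi.single_apply]; split_ifs <;> simp
  unfold rowVal edgeVec
  rw [hc, h2, h3, Matrix.one_mulVec]
  simp

lemma aux_row_P {E : Type*} (d n : ℕ) (tail head : E → Fin n)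
    (c : E → Fin d → ℤ) (qm qp : E → Fin d → ℝ) (x : RigDom d n) (e : E) (i j : Fin d)
    (h1 : ∀ r, c e r = if r = j then 1 else 0) (h2 : qm e = 0)
    (h3 : ∀ r, qp e r = if r = i then 1 else 0) :
    rowVal d n tail head 1 c qm qp x e =
      x.2.2 j j + x.2.2 i j + (x.2.1 (head e) j i - x.2.1 (head e) i j)
      + (x.1 (head e) i - x.1 (tail e) i) + (x.1 (head e) j - x.1 (tail e) j) := by
  have hc : (fun r => (c e r : ℝ)) = Pi.single j 1 := by
    funext r; rw [h1 r, Pi.single_apply]; split_ifs <;> simp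
  have hq : qp e = Pi.single i 1 := by
    funext r; rw [h3 r, Pi.single_apply]
  unfold rowVal edgeVec
  rw [hc, h2, hq, Matrix.one_mulVec]
  simp [dotProduct_add]
  ring

lemma aux_row_U {E : Type*} (d n : ℕ) (tail head : E → Fin n) (N : ℕ)
    (c : E → Fin d → ℤ) (qm qp : E → Fin d → ℝ) (x : RigDom d n) (e : E) (i j : Fin d)
    (h1 : ∀ r, c e r = (N : ℤ) * ((if r = i then 1 else 0) + (if r = j then 1 else 0)))
    (h2 : qm e = 0) (h3 : qp e = 0) :
    rowVal d n tail head 1 c qm qp x e =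
      (N : ℝ) ^ 2 * (x.2.2 i i + x.2.2 i j + x.2.2 j i + x.2.2 j j)
      + N * ((x.1 (head e) i - x.1 (tail e) i) + (x.1 (head e) j - x.1 (tail e) j)) := by
  have hc : (fun r => (c e r : ℝ)) = (N : ℝ) • (Pi.single i 1 + Pi.single j 1) := by
    funext r; rw [h1 r, Pi.smul_apply, Pi.add_apply, Pi.single_apply, Pi.single_apply]
    push_cast; simp
  unfold rowVal edgeVec
  rw [hc, h2, h3, Matrix.one_mulVec]
  simp [dotProduct_add, Matrix.mulVec_smul, Matrix.mulVec_add]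
  ring

lemma aux_eqv {V E : Type*} (tail head : E → V) (T : Finset E) (s : V → ℝ)
    (h : ∀ e ∈ T, s (head e) - s (tail e) = 0) (u v : V)
    (huv : Relation.EqvGen (adjRel tail head T) u v) : s u = s v := by
  induction huv with
  | rel a b hab =>
    obtain ⟨e, he, ⟨rfl, rfl⟩ | ⟨rfl, rfl⟩⟩ := hab <;> linarith [h e he]
  | refl => rfl
  | symm _ _ _ ih => exact ih.symm
  | trans _ _ _ _ _ h1 h2 => exact h1.trans h2

/-- On a spanning tree, any potential difference is realized. -/
lemma aux_tree_solve {V E : Type*} [Fintype V] (tail head : E → V) (T : Finset E)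
    (hT : IsSpanningTree tail head T) (b : E → ℝ) :
    ∃ p : V → ℝ, ∀ e ∈ T, p (head e) - p (tail e) = b e := by
  classical
  let L : (V → ℝ) →ₗ[ℝ] (T → ℝ) :=
    { toFun := fun p e => p (head e) - p (tail e)
      map_add' := by intro p q; funext e; simp; ring
      map_smul' := by intro p q; funext e; simp; ring }
  have hker : LinearMap.ker L ≤ Submodule.span ℝ {(fun _ => 1 : V → ℝ)} := by
    intro s hs
    have hs' : ∀ e ∈ T, s (head e) - s (tail e) = 0 := fun e he =>
      congrFun (LinearMap.mem_ker.1 hs) ⟨e, he⟩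
    rw [Submodule.mem_span_singleton]
    have : Nonempty V := Fintype.card_pos_iff.1 (by have := hT.1; omega)
    obtain ⟨v0⟩ := this
    refine ⟨s v0, ?_⟩
    funext v
    simpa using aux_eqv tail head T s hs' v0 v (hT.2 v0 v)
  have hk1 : Module.finrank ℝ (LinearMap.ker L) ≤ 1 :=
    (Submodule.finrank_mono hker).trans
      ((finrank_span_le_card _).trans (by simp))
  have hrn := L.finrank_range_add_finrank_ker
  have hr : LinearMap.range L = ⊤ := by
    apply Submodule.eq_top_of_finrank_eq
    apply le_antisymm (Submodule.finrank_le _)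
    have := hT.1
    simp only [Module.finrank_fintype_fun_eq_card, Fintype.card_coe] at hrn ⊢
    omega
  obtain ⟨p, hp⟩ := LinearMap.range_eq_top.1 hr (fun e => b e)
  exact ⟨p, fun e he => congrFun hp ⟨e, he⟩⟩

lemma aux_tree_bound {V E : Type*} [Fintype V] (tail head : E → V) (T : Finset E)
    (hT : IsSpanningTree tail head T) (s : V → ℝ)
    (hs : ∀ e ∈ T, s (head e) - s (tail e) = 1) (u v : V) :
    s u - s v < Fintype.card V := by
  classical
  let G : SimpleGraph V := SimpleGraph.fromRel (adjRel tail head T)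
  have hre : ∀ u v, Relation.EqvGen (adjRel tail head T) u v → G.Reachable u v := by
    intro u v h
    induction h with
    | rel a b hab =>
      by_cases h : a = b
      · subst h; exact SimpleGraph.Reachable.refl _
      · exact SimpleGraph.Adj.reachable (by
          rw [SimpleGraph.fromRel_adj]; exact ⟨h, Or.inl hab⟩)
    | refl => exact SimpleGraph.Reachable.refl _
    | symm _ _ _ ih => exact ih.symm
    | trans _ _ _ _ _ h1 h2 => exact h1.trans h2
  obtain ⟨w⟩ := hre u v (hT.2 u v)
  have hlen := (w.toPath).2.length_lt
  have hwalk : ∀ {a b : V} (w : G.Walk a b), s a - s b ≤ w.length := by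
    intro a b w
    induction w with
    | nil => simp
    | @cons a b c hab _ ih =>
      have hst : s a - s b ≤ 1 := by
        rw [SimpleGraph.fromRel_adj] at hab
        obtain ⟨_, ⟨e, he, ⟨rfl, rfl⟩ | ⟨rfl, rfl⟩⟩ | ⟨e, he, ⟨rfl, rfl⟩ | ⟨rfl, rfl⟩⟩⟩ := hab <;>
          linarith [hs e he]
      rw [SimpleGraph.Walk.length_cons]; push_cast; linarith
  have h1 := hwalk (w.toPath : G.Walk u v)
  have h2 : (((w.toPath : G.Walk u v).length : ℕ) : ℝ) < Fintype.card V := by exact_mod_cast hlen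
  linarith

/-- The tree system together with one extra edge is solvable. -/
lemma aux_tree_extra {n : ℕ} {E : Type*} (tail head : E → Fin n) (T : Finset E)
    (hT : IsSpanningTree tail head T) (N : ℕ) (hN : n < N) (b : E → ℝ) (f : E) :
    ∃ (p : Fin n → ℝ) (l : ℝ), (∀ e ∈ T, l + p (head e) - p (tail e) = b e) ∧
      (N : ℝ) ^ 2 * (4 * l) + N * (2 * (p (head f) - p (tail f))) = b f := by
  obtain ⟨q, hq⟩ := aux_tree_solve tail head T hT b
  obtain ⟨s, hs⟩ := aux_tree_solve tail head T hT (fun _ => 1)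
  have hb := aux_tree_bound tail head T hT s hs (head f) (tail f)
  rw [Fintype.card_fin] at hb
  have hN' : (n : ℝ) < N := by exact_mod_cast hN
  have hn0 : (0 : ℝ) ≤ n := by positivity
  set D := s (head f) - s (tail f) with hD
  have hden : (2 * N * (2 * N - D) : ℝ) ≠ 0 := by
    apply ne_of_gt
    apply mul_pos <;> linarith
  set l := (b f - 2 * N * (q (head f) - q (tail f))) / (2 * N * (2 * N - D)) with hl
  have hl' : l * (2 * N * (2 * N - D)) = b f - 2 * N * (q (head f) - q (tail f)) := by
    rw [hl]; exact div_mul_cancel₀ _ hden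
  refine ⟨fun v => q v - l * s v, l, ?_, ?_⟩
  · intro e he
    have h1 := hq e he
    have h2 := hs e he
    linear_combination h1 - l * h2
  · rw [hD] at hl'
    linear_combination hl'

lemma aux_choose (d : ℕ) : (d + 1).choose 2 = d.choose 2 + d := by
  rw [Nat.choose_succ_succ' d 1]; simp; ring

lemma aux_sq (d : ℕ) : d ^ 2 = d.choose 2 + (d + 1).choose 2 := by
  induction d with
  | zero => simp
  | succ d ih =>
    have h1 := aux_choose d
    have h2 := aux_choose (d + 1)
    have h3 : (d + 1) ^ 2 = d ^ 2 + 2 * d + 1 := by ring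
    omega

lemma aux_sum (d : ℕ) : ∑ i : Fin d, (i : ℕ) = d.choose 2 := by
  rw [Fin.sum_univ_eq_sum_range (fun i => i) d, Finset.sum_range_id, Nat.choose_two_right]

lemma aux_card_lt (d : ℕ) :
    Fintype.card {p : Fin d × Fin d // p.1 < p.2} = d.choose 2 := by
  rw [Fintype.card_subtype, Finset.card_filter, Fintype.sum_prod_type_right, ← aux_sum]
  refine Finset.sum_congr rfl fun j _ => ?_
  rw [← Finset.card_filter, Finset.filter_gt_eq_Iio, Fin.card_Iio]

lemma aux_card_le (d : ℕ) :
    Fintype.card {p : Fin d × Fin d // p.2 ≤ p.1} = (d + 1).choose 2 := by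
  rw [Fintype.card_subtype, Finset.card_filter, Fintype.sum_prod_type, aux_choose, ← aux_sum]
  have : ∀ i : Fin d, (∑ y : Fin d, if (i, y).2 ≤ (i, y).1 then 1 else 0) = (i : ℕ) + 1 := by
    intro i
    rw [← Finset.card_filter, Finset.filter_ge_eq_Iic, Fin.card_Iic]
  rw [Finset.sum_congr rfl fun i _ => this i, Finset.sum_add_distrib]
  simp

lemma aux_card {d n : ℕ} (hn : 1 ≤ n) {E : Type*} [Fintype E] [DecidableEq E]
    (tail head : E → Fin n)
    (T : Fin d → Finset E)
    (P : {p : Fin d × Fin d // p.1 < p.2} → Finset E)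
    (estar : {p : Fin d × Fin d // p.2 ≤ p.1} → E)
    (hT : ∀ i, IsSpanningTree tail head (T i))
    (hP : ∀ p, ∀ v : Fin n, ((P p).filter fun e => head e = v).card = 1)
    (hstar : Function.Injective estar)
    (hTT : ∀ i i', i ≠ i' → Disjoint (T i) (T i'))
    (hPP : ∀ p p', p ≠ p' → Disjoint (P p) (P p'))
    (hTP : ∀ i p, Disjoint (T i) (P p))
    (hTU : ∀ i p, estar p ∉ T i)
    (hPU : ∀ q p, estar p ∉ P q)
    (hcover : ∀ e : E, (∃ i, e ∈ T i) ∨ (∃ p, e ∈ P p) ∨ (∃ p, e = estar p)) :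
    Fintype.card E = (d + 1).choose 2 * (n - 1) + d ^ 2 := by
  have hTc : ∀ i, (T i).card = n - 1 := by
    intro i; have := (hT i).1; rw [Fintype.card_fin] at this; omega
  have hPc : ∀ p, (P p).card = n := by
    intro p
    rw [Finset.card_eq_sum_card_fiberwise (f := head) (t := Finset.univ) (by simp)]
    simp [hP p]
  have huniv : (Finset.univ : Finset E) =
      (Finset.univ.biUnion T ∪ Finset.univ.biUnion P) ∪ Finset.univ.image estar := by
    ext e
    rcases hcover e with h | h | ⟨p, h⟩
    · simp [h]
    · simp [h]
    · simp [h]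
  have hd1 : Disjoint (Finset.univ.biUnion T) (Finset.univ.biUnion P) := by
    simp only [Finset.disjoint_biUnion_left, Finset.disjoint_biUnion_right]
    intro p _ i _; exact hTP i p
  have hd2 : Disjoint (Finset.univ.biUnion T ∪ Finset.univ.biUnion P)
      (Finset.univ.image estar) := by
    rw [Finset.disjoint_right]
    intro e he
    obtain ⟨p, _, rfl⟩ := Finset.mem_image.1 he
    simp [hTU, hPU]
  have hlt := aux_card_lt d
  have hle := aux_card_le d
  have hch := aux_choose d
  have hsq := aux_sq d
  rw [← Finset.card_univ, huniv, Finset.card_union_of_disjoint hd2,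
    Finset.card_union_of_disjoint hd1,
    Finset.card_biUnion (fun i _ j _ h => hTT i j h),
    Finset.card_biUnion (fun i _ j _ h => hPP i j h),
    Finset.card_image_of_injective _ hstar]
  simp only [hTc, hPc, Finset.sum_const, Finset.card_univ, hlt, hle, smul_eq_mul, Fintype.card_fin]
  obtain ⟨m, rfl⟩ : ∃ m, n = m + 1 := ⟨n - 1, by omega⟩
  rw [hsq, hch]
  simp only [Nat.add_sub_cancel]
  ring

/-- explicit presentation of full rank: Proposition of the paper.
Suppose the edge set is partitioned into `d` edge-disjoint spanning trees `T i`,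
`C(d,2)` edge-disjoint spanning pseudo-forests `P ⟨(i,j)⟩` (`i < j`) oriented so that
every vertex has in-degree exactly one, and `C(d+1,2)` further edges `e*_{ij}` (`j ≤ i`).
Define a presentation by `Λ = I`, `c(e) = 𝐞_i, q⁻(e) = q⁺(e) = 0` on `T i`;
`c(e) = 𝐞_j, q⁻(e) = 0, q⁺(e) = 𝐞_i` on `P ⟨(i,j)⟩`; and
`c(e*_{ij}) = N(𝐞_i + 𝐞_j), q⁻ = q⁺ = 0` on `U`, where `N > n`.  Then the rigidity
matrix has full rank `|E| = C(d+1,2)(n−1) + d²`. -/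
theorem stmt_11 {d n : ℕ} (hd : 1 ≤ d) (hn : 1 ≤ n) {E : Type*} [Fintype E] [DecidableEq E]
    (tail head : E → Fin n) (N : ℕ) (hN : n < N)
    (T : Fin d → Finset E)
    (P : {p : Fin d × Fin d // p.1 < p.2} → Finset E)
    (estar : {p : Fin d × Fin d // p.2 ≤ p.1} → E)
    (hT : ∀ i, IsSpanningTree tail head (T i))
    (hP : ∀ p, ∀ v : Fin n, ((P p).filter fun e => head e = v).card = 1)
    (hstar : Function.Injective estar)
    (hTT : ∀ i i', i ≠ i' → Disjoint (T i) (T i'))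
    (hPP : ∀ p p', p ≠ p' → Disjoint (P p) (P p'))
    (hTP : ∀ i p, Disjoint (T i) (P p))
    (hTU : ∀ i p, estar p ∉ T i)
    (hPU : ∀ q p, estar p ∉ P q)
    (hcover : ∀ e : E, (∃ i, e ∈ T i) ∨ (∃ p, e ∈ P p) ∨ (∃ p, e = estar p))
    (c : E → Fin d → ℤ) (qm qp : E → Fin d → ℝ)
    (hcT : ∀ i, ∀ e ∈ T i,
      (∀ r, c e r = if r = i then 1 else 0) ∧ qm e = 0 ∧ qp e = 0)
    (hcP : ∀ p, ∀ e ∈ P p,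
      (∀ r, c e r = if r = p.1.2 then 1 else 0) ∧ qm e = 0 ∧
        (∀ r, qp e r = if r = p.1.1 then 1 else 0))
    (hcU : ∀ p,
      (∀ r, c (estar p) r =
          (N : ℤ) * ((if r = p.1.1 then 1 else 0) + (if r = p.1.2 then 1 else 0))) ∧
        qm (estar p) = 0 ∧ qp (estar p) = 0) :
    rigidityRank d n tail head (1 : Matrix (Fin d) (Fin d) ℝ) c qm qp Finset.univ
        = Fintype.card E ∧
      Fintype.card E = (d + 1).choose 2 * (n - 1) + d ^ 2 := by
  classical
  refine ⟨?_, aux_card hn tail head T P estar hT hP hstar hTT hPP hTP hTU hPU hcover⟩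
  have hN0 : (N : ℝ) ≠ 0 := by
    have : N ≠ 0 := by omega
    exact_mod_cast this
  have hsurj : ∀ b : E → ℝ, ∃ x : RigDom d n, ∀ e,
      rowVal d n tail head 1 c qm qp x e = b e := by
    intro b
    choose p l hpl hpu using fun i : Fin d =>
      aux_tree_extra tail head (T i) (hT i) N hN b (estar ⟨(i, i), le_refl i⟩)
    have hf : ∀ q v, ∃ e, (P q).filter (fun e => head e = v) = {e} := fun q v =>
      Finset.card_eq_one.1 (hP q v)
    choose f hf using hf
    have hfe : ∀ q, ∀ e ∈ P q, f q (head e) = e := by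
      intro q e he
      have : e ∈ (P q).filter (fun e' => head e' = head e) := by simp [he]
      rw [hf] at this
      exact (Finset.mem_singleton.1 this).symm
    let M : Matrix (Fin d) (Fin d) ℝ := fun i j =>
      if i = j then l i else if h : j < i then
        (b (estar ⟨(i, j), h.le⟩) - N * (
          (p i (head (estar ⟨(i, j), h.le⟩)) - p i (tail (estar ⟨(i, j), h.le⟩)))
          + (p j (head (estar ⟨(i, j), h.le⟩)) - p j (tail (estar ⟨(i, j), h.le⟩)))))
          / (N : ℝ) ^ 2 - l i - l j
      else 0
    have hMd : ∀ i, M i i = l i := fun i => by simp [M]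
    let B : Fin n → Matrix (Fin d) (Fin d) ℝ := fun v j i =>
      if h : i < j then
        b (f ⟨(i, j), h⟩ v) - (M j j + M i j
          + (p i v - p i (tail (f ⟨(i, j), h⟩ v))) + (p j v - p j (tail (f ⟨(i, j), h⟩ v))))
      else 0
    refine ⟨(fun v i => p i v, B, M), fun e => ?_⟩
    rcases hcover e with ⟨i, he⟩ | ⟨⟨⟨i, j⟩, hij⟩, he⟩ | ⟨⟨⟨i, j⟩, hij⟩, rfl⟩
    · obtain ⟨h1, h2, h3⟩ := hcT i e he
      rw [aux_row_T d n tail head c qm qp _ e i h1 h2 h3]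
      simp only [hMd]
      exact hpl i e he
    · obtain ⟨h1, h2, h3⟩ := hcP _ e he
      rw [aux_row_P d n tail head c qm qp _ e i j h1 h2 h3]
      have hij' : i < j := hij
      have hb1 : B (head e) i j = 0 := by simp [B, hij'.not_gt]
      have hb2 : B (head e) j i = b e - (M j j + M i j
          + (p i (head e) - p i (tail e)) + (p j (head e) - p j (tail e))) := by
        have := hfe _ e he
        simp only [B, dif_pos hij', this]
      simp only [hb1, hb2]
      ring
    · obtain ⟨h1, h2, h3⟩ := hcU ⟨(i, j), hij⟩
      rw [aux_row_U d n tail head N c qm qp _ _ i j h1 h2 h3]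
      rcases eq_or_lt_of_le (show j ≤ i from hij) with h | h
      · subst h
        simp only [hMd]
        linear_combination hpu j
      · have hm1 : M j i = 0 := by simp [M, h.ne, h.not_gt]
        have hm2 : M i j = (b (estar ⟨(i, j), h.le⟩) - N * (
          (p i (head (estar ⟨(i, j), h.le⟩)) - p i (tail (estar ⟨(i, j), h.le⟩)))
          + (p j (head (estar ⟨(i, j), h.le⟩)) - p j (tail (estar ⟨(i, j), h.le⟩)))))
          / (N : ℝ) ^ 2 - l i - l j := by simp [M, h.ne', h]
        simp only [hMd, hm1, hm2]
        field_simp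
        ring
  unfold rigidityRank
  have hrange : (Set.range fun x : RigDom d n => fun e : (Finset.univ : Finset E) =>
      rowVal d n tail head 1 c qm qp x e.1) = Set.univ := by
    rw [Set.range_eq_univ]
    intro b
    obtain ⟨x, hx⟩ := hsurj (fun e => b ⟨e, Finset.mem_univ e⟩)
    exact ⟨x, funext fun e => hx e.1⟩
  rw [hrange, Submodule.span_univ, finrank_top, Module.finrank_fintype_fun_eq_card]
  simp
end
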